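/- arXiv:2305.15631 — 3 statements merged into one kernel-verified Lean document; each statement's English description precedes it below -/
import Mathlib

section
/- Let s ≥ 2 and m ≥ 2 be integers and let F_1, …, F_m be nonempty, pairwise distinct families of 2-element subsets of [3s+1] such that F_i and F_j are cross-intersecting for all i ≠ j. Then Σ_{i=1}^m |F_i| ≤ 3sm. -/
open Finset

section CrossIntersecting

variable {α : Type*} [DecidableEq α]

/-- The pairs in `U` that contain `a`. -/
def pairStar (U : Finset α) (a : α) : Finset (Finset α) :=
  (U.erase a).image fun x => {a, x}

lemma card_pairStar_le {U : Finset α} {a : α} (ha : a ∈ U) : #(pairStar U a) ≤ #U - 1 :=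
  card_image_le.trans (card_erase_of_mem ha).le

lemma mem_pairStar {U e : Finset α} {a : α} (he : e ∈ powersetCard 2 U) (ha : a ∈ e) :
    e ∈ pairStar U a := by
  rw [mem_powersetCard, card_eq_two] at he
  obtain ⟨heU, x, y, hxy, rfl⟩ := he
  simp only [pairStar, mem_image, mem_erase]
  simp only [mem_insert, mem_singleton] at ha
  rcases ha with rfl | rfl
  · exact ⟨y, ⟨hxy.symm, heU (by simp)⟩, rfl⟩
  · exact ⟨x, ⟨hxy, heU (by simp)⟩, pair_comm _ _⟩

lemma eq_pair_of_mem {U e : Finset α} {a b : α} (he : e ∈ powersetCard 2 U) (hab : a ≠ b)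
    (ha : a ∈ e) (hb : b ∈ e) : e = {a, b} := by
  rw [mem_powersetCard] at he
  refine (eq_of_subset_of_card_le ?_ ?_).symm
  · simp [insert_subset_iff, ha, hb]
  · rw [he.2, card_pair hab]

lemma exists_mem_of_inter_pair {e : Finset α} {a b : α} (h : (e ∩ {a, b}).Nonempty) :
    a ∈ e ∨ b ∈ e := by
  obtain ⟨x, hx⟩ := h
  simp only [mem_inter, mem_insert, mem_singleton] at hx
  rcases hx with ⟨hx, rfl | rfl⟩ <;> simp [hx]

lemma card_le_of_inter_edge {U e : Finset α} {A : Finset (Finset α)}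
    (hA : A ⊆ powersetCard 2 U) (he : e ∈ powersetCard 2 U)
    (h : ∀ f ∈ A, (f ∩ e).Nonempty) : #A ≤ 2 * #U - 3 := by
  rw [mem_powersetCard, card_eq_two] at he
  obtain ⟨heU, a, b, hab, rfl⟩ := he
  have ha : a ∈ U := heU (by simp)
  have hb : b ∈ U := heU (by simp)
  have hsub : A ⊆ pairStar U a ∪ pairStar (U.erase a) b := by
    intro f hf
    rw [mem_union]
    by_cases haf : a ∈ f
    · exact Or.inl (mem_pairStar (hA hf) haf)
    · right
      have hbf := (exists_mem_of_inter_pair (h f hf)).resolve_left haf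
      have hfU := mem_powersetCard.1 (hA hf)
      exact mem_pairStar (mem_powersetCard.2 ⟨subset_erase.2 ⟨hfU.1, haf⟩, hfU.2⟩) hbf
  have h1 := (card_le_card hsub).trans (card_union_le _ _)
  have h2 := card_pairStar_le ha
  have h3 := card_pairStar_le (U := U.erase a) (mem_erase.2 ⟨hab.symm, hb⟩)
  rw [card_erase_of_mem ha] at h3
  have h4 : 2 ≤ #U := by rw [← card_pair hab]; exact card_le_card heU
  omega

lemma card_le_four_of_inter_disjoint {U e e' : Finset α} {A : Finset (Finset α)}
    (hA : A ⊆ powersetCard 2 U) (he : e ∈ powersetCard 2 U) (he' : e' ∈ powersetCard 2 U)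
    (hd : ¬ (e ∩ e').Nonempty) (h : ∀ f ∈ A, (f ∩ e).Nonempty)
    (h' : ∀ f ∈ A, (f ∩ e').Nonempty) : #A ≤ 4 := by
  have hsub : A ⊆ (e ×ˢ e').image fun p => {p.1, p.2} := by
    intro f hf
    obtain ⟨x, hx⟩ := h f hf
    obtain ⟨y, hy⟩ := h' f hf
    rw [mem_inter] at hx hy
    have hxy : x ≠ y := by
      rintro rfl
      exact hd ⟨x, mem_inter.2 ⟨hx.2, hy.2⟩⟩
    exact mem_image.2
      ⟨(x, y), mem_product.2 ⟨hx.2, hy.2⟩, (eq_pair_of_mem (hA hf) hxy hx.1 hy.1).symm⟩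
  refine (card_le_card hsub).trans (card_image_le.trans ?_)
  rw [card_product, (mem_powersetCard.1 he).2, (mem_powersetCard.1 he').2]

/-- Pairs meeting each of two distinct but intersecting pairs contain the common vertex, with at
most one exception. -/
lemma exists_pairStar_of_inter {U e e' : Finset α} {A : Finset (Finset α)}
    (hA : A ⊆ powersetCard 2 U) (he : e ∈ powersetCard 2 U) (he' : e' ∈ powersetCard 2 U)
    (hne : e ≠ e') (hi : (e ∩ e').Nonempty) (h : ∀ f ∈ A, (f ∩ e).Nonempty)
    (h' : ∀ f ∈ A, (f ∩ e').Nonempty) :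
    ∃ a ∈ U, ∃ g, A ⊆ insert g (pairStar U a) ∧ a ∉ g ∧ #g = 2 := by
  obtain ⟨a, ha⟩ := hi
  rw [mem_inter] at ha
  have hU := (mem_powersetCard.1 he).1 ha.1
  have h1 := mem_pairStar he ha.1
  have h2 := mem_pairStar he' ha.2
  simp only [pairStar, mem_image, mem_erase] at h1 h2
  obtain ⟨b, ⟨hba, -⟩, rfl⟩ := h1
  obtain ⟨c, ⟨hca, -⟩, rfl⟩ := h2
  have hbc : b ≠ c := by rintro rfl; exact hne rfl
  refine ⟨a, hU, {b, c}, ?_, by simp [hba.symm, hca.symm], card_pair hbc⟩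
  intro f hf
  rw [mem_insert]
  by_cases haf : a ∈ f
  · exact Or.inr (mem_pairStar (hA hf) haf)
  · exact Or.inl (eq_pair_of_mem (hA hf) hbc
      ((exists_mem_of_inter_pair (h f hf)).resolve_left haf)
      ((exists_mem_of_inter_pair (h' f hf)).resolve_left haf))

lemma card_le_of_inter_two {U e e' : Finset α} {A : Finset (Finset α)} (hU : 4 ≤ #U)
    (hA : A ⊆ powersetCard 2 U) (he : e ∈ powersetCard 2 U) (he' : e' ∈ powersetCard 2 U)
    (hne : e ≠ e') (h : ∀ f ∈ A, (f ∩ e).Nonempty) (h' : ∀ f ∈ A, (f ∩ e').Nonempty) :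
    #A ≤ #U := by
  by_cases hi : (e ∩ e').Nonempty
  · obtain ⟨a, ha, g, hg, -⟩ := exists_pairStar_of_inter hA he he' hne hi h h'
    have h1 := (card_le_card hg).trans (card_insert_le _ _)
    have h2 := card_pairStar_le ha
    omega
  · exact (card_le_four_of_inter_disjoint hA he he' hi h h').trans hU

lemma card_le_of_intersecting {U : Finset α} {A : Finset (Finset α)} (hU : 4 ≤ #U)
    (hA : A ⊆ powersetCard 2 U) (hI : ∀ e ∈ A, ∀ f ∈ A, (e ∩ f).Nonempty) :
    #A ≤ #U - 1 := by
  by_cases h1 : #A ≤ 1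
  · omega
  obtain ⟨e, he, e', he', hne⟩ := one_lt_card.1 (not_le.1 h1)
  obtain ⟨a, ha, g, hg, hag, hg2⟩ := exists_pairStar_of_inter hA (hA he) (hA he') hne
    (hI e he e' he') (fun f hf => hI f hf e he) (fun f hf => hI f hf e' he')
  by_cases hgA : g ∈ A
  · have hsub : A ⊆ insert g (g.image fun x => {a, x}) := by
      intro f hf
      rcases mem_insert.1 (hg hf) with rfl | hfs
      · exact mem_insert_self _ _
      · simp only [pairStar, mem_image, mem_erase] at hfs
        obtain ⟨x, -, rfl⟩ := hfs
        have hx := (exists_mem_of_inter_pair (hI g hgA _ hf)).resolve_left hag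
        exact mem_insert_of_mem (mem_image_of_mem _ hx)
    have h2 := (card_le_card hsub).trans (card_insert_le _ _)
    have h3 : #(g.image fun x => ({a, x} : Finset α)) ≤ #g := card_image_le
    omega
  · exact (card_le_card ((subset_insert_iff_of_notMem hgA).1 hg)).trans (card_pairStar_le ha)

theorem card_add_card_le_of_cross_intersecting {U : Finset α} {A B : Finset (Finset α)}
    (hU : 6 ≤ #U) (hA : A ⊆ powersetCard 2 U) (hB : B ⊆ powersetCard 2 U)
    (hA0 : A.Nonempty) (hB0 : B.Nonempty) (h : ∀ e ∈ A, ∀ f ∈ B, (e ∩ f).Nonempty) :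
    #A + #B ≤ 2 * (#U - 1) := by
  have h' : ∀ f ∈ B, ∀ e ∈ A, (f ∩ e).Nonempty := fun f hf e he => by
    rw [inter_comm]; exact h e he f hf
  by_cases hA1 : #A ≤ 1
  · obtain ⟨e, he⟩ := hA0
    have := card_le_of_inter_edge hB (hA he) fun f hf => h' f hf e he
    omega
  by_cases hB1 : #B ≤ 1
  · obtain ⟨e, he⟩ := hB0
    have := card_le_of_inter_edge hA (hB he) fun f hf => h f hf e he
    omega
  obtain ⟨a, ha, a', ha', hane⟩ := one_lt_card.1 (not_le.1 hA1)
  obtain ⟨b, hb, b', hb', hbne⟩ := one_lt_card.1 (not_le.1 hB1)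
  have hAU := card_le_of_inter_two (by omega) hA (hB hb) (hB hb') hbne
    (fun f hf => h f hf b hb) (fun f hf => h f hf b' hb')
  have hBU := card_le_of_inter_two (by omega) hB (hA ha) (hA ha') hane
    (fun f hf => h' f hf a ha) (fun f hf => h' f hf a' ha')
  by_cases hAI : ∀ e ∈ A, ∀ f ∈ A, (e ∩ f).Nonempty
  · by_cases hBI : ∀ e ∈ B, ∀ f ∈ B, (e ∩ f).Nonempty
    · have h1 := card_le_of_intersecting (by omega) hA hAI
      have h2 := card_le_of_intersecting (by omega) hB hBI
      omega
    · push Not at hBI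
      obtain ⟨e, he, f, hf, hef⟩ := hBI
      have := card_le_four_of_inter_disjoint hA (hB he) (hB hf) (by simp [hef])
        (fun x hx => h x hx e he) (fun x hx => h x hx f hf)
      omega
  · push Not at hAI
    obtain ⟨e, he, f, hf, hef⟩ := hAI
    have := card_le_four_of_inter_disjoint hB (hA he) (hA hf) (by simp [hef])
      (fun x hx => h' x hx e he) (fun x hx => h' x hx f hf)
    omega

end CrossIntersecting

/-- If any two values of `f` at distinct indices sum to at most `2 * c`, then the average of `f`
is at most `c`. -/
lemma sum_le_mul_card_of_pairwise_add_le {ι : Type*} [Fintype ι] [DecidableEq ι] (f : ι → ℕ)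
    (c : ℕ) (hι : 2 ≤ Fintype.card ι) (h : ∀ i j, i ≠ j → f i + f j ≤ 2 * c) :
    ∑ i, f i ≤ c * Fintype.card ι := by
  by_cases hle : ∀ i, f i ≤ c
  · calc ∑ i, f i ≤ ∑ _i : ι, c := sum_le_sum fun i _ => hle i
      _ = c * Fintype.card ι := by simp [mul_comm]
  · push Not at hle
    obtain ⟨i, hi⟩ := hle
    have : Nontrivial ι := Fintype.one_lt_card_iff_nontrivial.1 hι
    obtain ⟨j, hj⟩ := exists_ne i
    have hrest : ∑ k ∈ (univ.erase i).erase j, f k ≤ ∑ _k ∈ (univ.erase i).erase j, c := by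
      refine sum_le_sum fun k hk => ?_
      have := h i k (ne_of_mem_erase (mem_of_mem_erase hk)).symm
      omega
    have hji : j ∈ univ.erase i := mem_erase.2 ⟨hj, mem_univ j⟩
    have hc : ∑ _k : ι, c = c * Fintype.card ι := by simp [mul_comm]
    rw [← hc, ← add_sum_erase univ f (mem_univ i), ← add_sum_erase _ f hji,
      ← add_sum_erase univ (fun _ => c) (mem_univ i), ← add_sum_erase _ (fun _ => c) hji]
    have := h i j hj.symm
    omega

/-- Nonempty, pairwise distinct, pairwise cross-intersecting families of 2-subsets of
`[3s+1]` have total size at most `3sm`. -/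
theorem cross_intersecting_families_sum_bound (s m : ℕ) (hs : 2 ≤ s) (hm : 2 ≤ m)
    (F : Fin m → Finset (Finset ℕ))
    (hsub : ∀ i, F i ⊆ Finset.powersetCard 2 (Finset.Icc 1 (3 * s + 1)))
    (hne : ∀ i, (F i).Nonempty)
    (hdistinct : Function.Injective F)
    (hcross : ∀ i j, i ≠ j → ∀ A ∈ F i, ∀ B ∈ F j, (A ∩ B).Nonempty) :
    ∑ i, (F i).card ≤ 3 * s * m := by
  have key := sum_le_mul_card_of_pairwise_add_le (fun i => #(F i)) (3 * s) (by simpa using hm)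
    fun i j hij => by
      have := card_add_card_le_of_cross_intersecting (by rw [Nat.card_Icc]; omega) (hsub i)
        (hsub j) (hne i) (hne j) (hcross i j hij)
      rw [Nat.card_Icc] at this
      omega
  simpa using key
end

section
/- Let ε and β be real constants with 0 < ε < 10^{-6} and 3√ε < β < 1. There exists a positive integer n_0 such that for every n > n_0 the following holds: if H is a 3-graph on vertex set [n] with e(H) > (1−ε)·binom(n,3) and d_H(v) > βn^2 for every vertex v ∈ [n], then H has a matching covering all but at most two vertices. -/
open Finset

/-- The edge set of the complete `k`-uniform hypergraph on vertex set `Fin n`. -/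
def completeEdges (n k : ℕ) : Finset (Finset (Fin n)) :=
  Finset.powersetCard k Finset.univ

/-- A family of finsets is a matching if its members are pairwise disjoint. -/
def IsMatchingFam {α : Type*} [DecidableEq α] (M : Finset (Finset α)) : Prop :=
  (M : Set (Finset α)).Pairwise Disjoint

/-- The number of triples containing `v` that are not edges of `H`. -/
def missingDegree {n : ℕ} (H : Finset (Finset (Fin n))) (v : Fin n) : ℕ :=
  ((completeEdges n 3 \ H).filter (fun e => v ∈ e)).card

section Matching

variable {α : Type*} [DecidableEq α]

lemma IsMatchingFam.union {M N : Finset (Finset α)} (hM : IsMatchingFam M)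
    (hN : IsMatchingFam N) (h : ∀ e ∈ M, ∀ f ∈ N, Disjoint e f) : IsMatchingFam (M ∪ N) := by
  intro e he f hf hef
  simp only [coe_union, Set.mem_union, mem_coe] at he hf
  rcases he with he | he <;> rcases hf with hf | hf
  · exact hM he hf hef
  · exact h e he f hf
  · exact (h f hf e he).symm
  · exact hN he hf hef

lemma IsMatchingFam.subset {M N : Finset (Finset α)} (hM : IsMatchingFam M) (h : N ⊆ M) :
    IsMatchingFam N :=
  Set.Pairwise.mono (by exact_mod_cast h) hM

lemma isMatchingFam_singleton (e : Finset α) : IsMatchingFam {e} := by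
  simp [IsMatchingFam]

/-- Two edges of a maximum matching cannot be exchanged for three edges through three uncovered
vertices, so some transversal triple is not an edge. -/
lemma exists_missing_of_maximum_matching {H M : Finset (Finset α)}
    (hH : ∀ e ∈ H, e.card = 3) (hMH : M ⊆ H) (hM : IsMatchingFam M)
    (hmax : ∀ N ⊆ H, IsMatchingFam N → N.card ≤ M.card)
    {a b c : α} (hab : a ≠ b) (hac : a ≠ c) (hbc : b ≠ c)
    (ha : ∀ g ∈ M, a ∉ g) (hb : ∀ g ∈ M, b ∉ g) (hc : ∀ g ∈ M, c ∉ g)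
    {e f : Finset α} (he : e ∈ M) (hf : f ∈ M) (hef : e ≠ f) :
    ∃ t, t ∉ H ∧ t.card = 3 ∧ (a ∈ t ∨ b ∈ t ∨ c ∈ t) ∧ t ⊆ {a, b, c} ∪ e ∪ f ∧
      ¬ Disjoint t e ∧ ¬ Disjoint t f := by
  have hd : Disjoint e f := hM he hf hef
  obtain ⟨x₁, x₂, x₃, hx12, hx13, hx23, rfl⟩ := card_eq_three.1 (hH e (hMH he))
  obtain ⟨y₁, y₂, y₃, hy12, hy13, hy23, rfl⟩ := card_eq_three.1 (hH f (hMH hf))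
  have hae := ha _ he
  have hbe := hb _ he
  have hce := hc _ he
  have haf := ha _ hf
  have hbf := hb _ hf
  have hcf := hc _ hf
  simp only [disjoint_insert_left, disjoint_singleton_left, mem_insert, mem_singleton,
    not_or] at hd hae hbe hce haf hbf hcf
  by_contra hcon
  have key : ∀ v x y, v ∈ ({a, b, c} : Finset α) → x ∈ ({x₁, x₂, x₃} : Finset α) →
      y ∈ ({y₁, y₂, y₃} : Finset α) → ({v, x, y} : Finset α) ∈ H := by
    intro v x y hv hx hy
    by_contra hn
    have hvx : v ≠ x := by
      rintro rfl
      simp only [mem_insert, mem_singleton] at hv hx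
      grind
    have hvy : v ≠ y := by
      rintro rfl
      simp only [mem_insert, mem_singleton] at hv hy
      grind
    have hxy : x ≠ y := by
      rintro rfl
      simp only [mem_insert, mem_singleton] at hx hy
      grind
    refine hcon ⟨{v, x, y}, hn, card_eq_three.2 ⟨v, x, y, hvx, hvy, hxy, rfl⟩, ?_, ?_, ?_, ?_⟩
    · simp only [mem_insert, mem_singleton] at hv ⊢
      grind
    · intro z hz
      simp only [mem_union]
      rcases mem_insert.1 hz with rfl | hz
      · exact .inl (.inl hv)
      · rcases mem_insert.1 hz with rfl | hz
        · exact .inl (.inr hx)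
        · rw [mem_singleton.1 hz]
          exact .inr hy
    · exact not_disjoint_iff.2 ⟨x, by simp, hx⟩
    · exact not_disjoint_iff.2 ⟨y, by simp, hy⟩
  have h1 := key a x₁ y₁ (by simp) (by simp) (by simp)
  have h2 := key b x₂ y₂ (by simp) (by simp) (by simp)
  have h3 := key c x₃ y₃ (by simp) (by simp) (by simp)
  have d12 : Disjoint ({a, x₁, y₁} : Finset α) {b, x₂, y₂} := by
    simp only [disjoint_insert_left, disjoint_singleton_left, mem_insert, mem_singleton]
    grind
  have d13 : Disjoint ({a, x₁, y₁} : Finset α) {c, x₃, y₃} := by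
    simp only [disjoint_insert_left, disjoint_singleton_left, mem_insert, mem_singleton]
    grind
  have d23 : Disjoint ({b, x₂, y₂} : Finset α) {c, x₃, y₃} := by
    simp only [disjoint_insert_left, disjoint_singleton_left, mem_insert, mem_singleton]
    grind
  set e : Finset α := {x₁, x₂, x₃} with he_def
  set f : Finset α := {y₁, y₂, y₃} with hf_def
  set T : Finset (Finset α) := {{a, x₁, y₁}, {b, x₂, y₂}, {c, x₃, y₃}} with hT
  have hTcard : T.card = 3 := by
    refine card_eq_three.2 ⟨_, _, _, ?_, ?_, ?_, rfl⟩
    · exact fun h => disjoint_left.1 d12 (mem_insert_self _ _) (h ▸ mem_insert_self _ _)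
    · exact fun h => disjoint_left.1 d13 (mem_insert_self _ _) (h ▸ mem_insert_self _ _)
    · exact fun h => disjoint_left.1 d23 (mem_insert_self _ _) (h ▸ mem_insert_self _ _)
  have hTm : IsMatchingFam T := by
    intro u hu v hv huv
    simp only [hT, coe_insert, coe_singleton, Set.mem_insert_iff, Set.mem_singleton_iff] at hu hv
    rcases hu with rfl | rfl | rfl <;> rcases hv with rfl | rfl | rfl <;>
      first
        | exact absurd rfl huv
        | assumption
        | (apply Disjoint.symm; assumption)
  have hcross : ∀ g ∈ M \ {e, f}, ∀ t ∈ T, Disjoint g t := by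
    intro g hg t ht
    simp only [mem_sdiff, mem_insert, mem_singleton, not_or] at hg
    have hge : Disjoint g e := hM hg.1 he hg.2.1
    have hgf : Disjoint g f := hM hg.1 hf hg.2.2
    have := ha g hg.1
    have := hb g hg.1
    have := hc g hg.1
    simp only [he_def, hf_def, disjoint_insert_right, disjoint_singleton_right] at hge hgf
    simp only [hT, mem_insert, mem_singleton] at ht
    rcases ht with rfl | rfl | rfl <;>
      simp only [disjoint_insert_right, disjoint_singleton_right] <;> tauto
  have hdT : Disjoint (M \ {e, f}) T := by
    rw [disjoint_left]
    intro g hg hgT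
    have h0 := hcross g hg g hgT
    rw [disjoint_self_iff_empty] at h0
    have := hH g (hMH (mem_sdiff.1 hg).1)
    simp [h0] at this
  have hcard := hmax ((M \ {e, f}) ∪ T) ?_ ((hM.subset sdiff_subset).union hTm hcross)
  · rw [card_union_of_disjoint hdT, hTcard, card_sdiff_of_subset, card_pair hef] at hcard
    · have : ({e, f} : Finset (Finset α)).card ≤ M.card :=
        card_le_card (by simp [insert_subset_iff, he, hf])
      rw [card_pair hef] at this
      omega
    · simp [insert_subset_iff, he, hf]
  · refine union_subset (sdiff_subset.trans hMH) ?_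
    simp [hT, insert_subset_iff, h1, h2, h3]

lemma IsMatchingFam.card_biUnion {M : Finset (Finset α)} (hM : IsMatchingFam M)
    (h3 : ∀ e ∈ M, e.card = 3) : (M.biUnion id).card = 3 * M.card := by
  rw [Finset.card_biUnion (t := id) (fun e he f hf hef => hM he hf hef)]
  exact (sum_const_nat h3).trans (mul_comm _ _)

end Matching

section Counting

variable {n : ℕ} {H : Finset (Finset (Fin n))}

lemma mem_completeEdges_three {e : Finset (Fin n)} : e ∈ completeEdges n 3 ↔ e.card = 3 := by
  simp [completeEdges]

/-- In a maximum matching inside `W`, the pairs of matching edges inject into the missing triples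
at any three uncovered vertices of `W`. -/
lemma choose_two_card_le_missingDegree {M : Finset (Finset (Fin n))} {W : Finset (Fin n)}
    (hH : H ⊆ completeEdges n 3) (hMH : M ⊆ H.filter (· ⊆ W)) (hM : IsMatchingFam M)
    (hmax : ∀ N ⊆ H.filter (· ⊆ W), IsMatchingFam N → N.card ≤ M.card)
    {a b c : Fin n} (hab : a ≠ b) (hac : a ≠ c) (hbc : b ≠ c)
    (ha : a ∈ W \ M.biUnion id) (hb : b ∈ W \ M.biUnion id) (hc : c ∈ W \ M.biUnion id) :
    M.card.choose 2 ≤ missingDegree H a + missingDegree H b + missingDegree H c := by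
  simp only [mem_sdiff, mem_biUnion, id, not_exists, not_and] at ha hb hc
  have hex : ∀ s ∈ powersetCard 2 M, ∃ t, t ∈ completeEdges n 3 \ H ∧
      (a ∈ t ∨ b ∈ t ∨ c ∈ t) ∧ M.filter (fun g => ¬ Disjoint t g) = s := by
    intro s hs
    obtain ⟨hsM, hs2⟩ := mem_powersetCard.1 hs
    obtain ⟨e, f, hef, rfl⟩ := card_eq_two.1 hs2
    have he : e ∈ M := hsM (by simp)
    have hf : f ∈ M := hsM (by simp)
    obtain ⟨t, htH, ht3, htabc, htsub, hte, htf⟩ := exists_missing_of_maximum_matching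
      (fun e he => mem_completeEdges_three.1 (hH (mem_filter.1 he).1)) hMH hM hmax hab hac hbc
      ha.2 hb.2 hc.2 he hf hef
    have htW : t ⊆ W := by
      refine htsub.trans (union_subset (union_subset ?_ ?_) ?_)
      · simp [insert_subset_iff, ha.1, hb.1, hc.1]
      · exact (mem_filter.1 (hMH he)).2
      · exact (mem_filter.1 (hMH hf)).2
    refine ⟨t, mem_sdiff.2 ⟨mem_completeEdges_three.2 ht3, fun h => htH (mem_filter.2 ⟨h, htW⟩)⟩,
      htabc, ?_⟩
    ext g
    simp only [mem_filter, mem_insert, mem_singleton]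
    constructor
    · rintro ⟨hg, hgt⟩
      by_contra hne
      push Not at hne
      apply hgt
      refine disjoint_of_subset_left htsub ?_
      simp only [disjoint_union_left, disjoint_insert_left, disjoint_singleton_left]
      exact ⟨⟨⟨ha.2 g hg, hb.2 g hg, hc.2 g hg⟩, hM he hg hne.1.symm⟩, hM hf hg hne.2.symm⟩
    · rintro (rfl | rfl)
      · exact ⟨he, hte⟩
      · exact ⟨hf, htf⟩
  choose! φ hφ using hex
  rw [← card_powersetCard]
  calc (powersetCard 2 M).card
      ≤ ((completeEdges n 3 \ H).filter (fun e => a ∈ e) ∪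
          (completeEdges n 3 \ H).filter (fun e => b ∈ e) ∪
          (completeEdges n 3 \ H).filter (fun e => c ∈ e)).card := by
        refine card_le_card_of_injOn φ (fun s hs => ?_) (fun s hs t ht hst => ?_)
        · obtain ⟨h1, h2, -⟩ := hφ s hs
          simp only [coe_union, Set.mem_union, mem_coe, mem_filter]
          tauto
        · rw [← (hφ s hs).2.2, hst, (hφ t ht).2.2]
    _ ≤ _ := (card_union_le _ _).trans (Nat.add_le_add_right (card_union_le _ _) _)

/-- The pairs in an edge-free set inject into the missing triples at any vertex of the set. -/
lemma choose_two_le_missingDegree_of_independent {R : Finset (Fin n)}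
    (hR : ∀ e ∈ H, ¬ e ⊆ R) {a : Fin n} (ha : a ∈ R) :
    (R.card - 1).choose 2 ≤ missingDegree H a := by
  rw [← card_erase_of_mem ha, ← card_powersetCard]
  have hna : ∀ s ∈ powersetCard 2 (R.erase a), a ∉ s := fun s hs h =>
    notMem_erase a R ((mem_powersetCard.1 hs).1 h)
  refine card_le_card_of_injOn (insert a) (fun s hs => ?_) (fun s hs t ht hst => ?_)
  · have hs' := mem_powersetCard.1 hs
    simp only [mem_coe, mem_filter, mem_sdiff, mem_insert_self, and_true, mem_completeEdges_three]
    refine ⟨by rw [card_insert_of_notMem (hna s hs), hs'.2], fun h => hR _ h ?_⟩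
    exact insert_subset ha (hs'.1.trans (erase_subset _ _))
  · rw [← erase_insert (hna s hs), hst, erase_insert (hna t ht)]

/-- Few triples contain `v` and meet a given set avoiding `v`. -/
lemma card_filter_mem_not_disjoint_le (hH : H ⊆ completeEdges n 3) {v : Fin n}
    {U : Finset (Fin n)} (hv : v ∉ U) :
    (H.filter (fun e => v ∈ e ∧ ¬ Disjoint e U)).card ≤ U.card * n := by
  calc _ ≤ ((U ×ˢ (univ : Finset (Fin n))).image (fun p => ({v, p.1, p.2} : Finset _))).card := by
        refine card_le_card fun e he => ?_
        obtain ⟨heH, hve, hd⟩ := mem_filter.1 he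
        obtain ⟨u, hue, huU⟩ := not_disjoint_iff.1 hd
        have huv : u ≠ v := fun h => hv (h ▸ huU)
        have h3 := mem_completeEdges_three.1 (hH heH)
        have h1 : ((e.erase v).erase u).card = 1 := by
          rw [card_erase_of_mem (mem_erase.2 ⟨huv, hue⟩), card_erase_of_mem hve, h3]
        obtain ⟨w, hw⟩ := card_eq_one.1 h1
        refine mem_image.2 ⟨(u, w), by simp [huU], ?_⟩
        dsimp only
        rw [← hw, insert_erase (mem_erase.2 ⟨huv, hue⟩), insert_erase hve]
    _ ≤ _ := card_image_le.trans (by simp)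

/-- A small set of vertices of large degree can be covered greedily by a matching. -/
lemma exists_matching_covering (hH : H ⊆ completeEdges n 3) (B : Finset (Fin n))
    (hdeg : ∀ v ∈ B, 3 * B.card * n < (H.filter (fun e => v ∈ e)).card) :
    ∃ M ⊆ H, IsMatchingFam M ∧ M.card ≤ B.card ∧ B ⊆ M.biUnion id := by
  suffices h : ∀ C ⊆ B, ∃ M ⊆ H, IsMatchingFam M ∧ M.card ≤ C.card ∧ C ⊆ M.biUnion id from
    h B subset_rfl
  intro C
  induction C using Finset.induction_on with
  | empty => exact fun _ => ⟨∅, by simp, by simp [IsMatchingFam], by simp, by simp⟩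
  | insert v C hvC ih =>
    intro hCB
    obtain ⟨M, hMH, hM, hMc, hCM⟩ := ih ((subset_insert _ _).trans hCB)
    by_cases hv : v ∈ M.biUnion id
    · exact ⟨M, hMH, hM, hMc.trans (card_le_card (subset_insert _ _)), insert_subset hv hCM⟩
    · have hlt : (H.filter (fun e => v ∈ e ∧ ¬ Disjoint e (M.biUnion id))).card <
          (H.filter (fun e => v ∈ e)).card := by
        refine (card_filter_mem_not_disjoint_le hH hv).trans_lt
          (lt_of_le_of_lt ?_ (hdeg v (hCB (mem_insert_self _ _))))
        rw [hM.card_biUnion fun e he => mem_completeEdges_three.1 (hH (hMH he))]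
        have := card_le_card ((subset_insert v C).trans hCB)
        gcongr
        omega
      obtain ⟨e, he, hne⟩ := exists_mem_notMem_of_card_lt_card hlt
      obtain ⟨heH, hve⟩ := mem_filter.1 he
      have hd : Disjoint e (M.biUnion id) := by
        by_contra hd
        exact hne (mem_filter.2 ⟨heH, hve, hd⟩)
      refine ⟨{e} ∪ M, union_subset (by simpa using heH) hMH,
        (isMatchingFam_singleton e).union hM ?_, ?_, ?_⟩
      · intro g hg f hf
        rw [mem_singleton.1 hg]
        exact disjoint_of_subset_right (subset_biUnion_of_mem id hf) hd
      · refine (card_union_le _ _).trans ?_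
        rw [card_insert_of_notMem hvC, card_singleton]
        omega
      · rw [union_biUnion, singleton_biUnion]
        exact insert_subset (mem_union_left _ hve) (hCM.trans subset_union_right)

lemma sum_missingDegree (H : Finset (Finset (Fin n))) :
    ∑ v, missingDegree H v = 3 * (completeEdges n 3 \ H).card := by
  simp only [missingDegree, card_filter]
  rw [sum_comm]
  have : ∀ e ∈ completeEdges n 3 \ H, ∑ v : Fin n, (if v ∈ e then 1 else 0) = 3 := by
    intro e he
    rw [← card_filter, filter_mem_eq_inter, univ_inter]
    exact mem_completeEdges_three.1 (mem_sdiff.1 he).1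
  rw [sum_congr rfl this]
  simp [mul_comm]

/-- In a dense 3-graph only few vertices have large missing degree. -/
lemma card_large_missingDegree_le (hH : H ⊆ completeEdges n 3) {s : ℝ} (hs : 0 < s) (hn : 0 < n)
    (hcard : (1 - s ^ 2) * (n.choose 3 : ℝ) < (H.card : ℝ)) :
    ((univ.filter (fun v => s * (n : ℝ) ^ 2 / 2 < missingDegree H v)).card : ℝ) ≤ s * n := by
  set B := univ.filter (fun v => s * (n : ℝ) ^ 2 / 2 < missingDegree H v) with hB
  have hn' : (0 : ℝ) < n := by exact_mod_cast hn
  have h1 : (B.card : ℝ) * (s * (n : ℝ) ^ 2 / 2) ≤ ∑ v, (missingDegree H v : ℝ) := by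
    rw [← nsmul_eq_mul]
    refine (card_nsmul_le_sum B _ _ fun v hv => (mem_filter.1 hv).2.le).trans ?_
    exact sum_le_sum_of_subset_of_nonneg (subset_univ _) fun _ _ _ => by positivity
  have h2 : ∑ v, (missingDegree H v : ℝ) = 3 * ((n.choose 3 : ℝ) - H.card) := by
    rw [← Nat.cast_sum, sum_missingDegree, Nat.cast_mul, cast_card_sdiff hH]
    simp [completeEdges]
  have h3 : (n.choose 3 : ℝ) ≤ (n : ℝ) ^ 3 / 6 := by
    simpa [Nat.factorial] using Nat.choose_le_pow_div (α := ℝ) 3 n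
  have h4 : s ^ 2 * (n.choose 3 : ℝ) ≤ s ^ 2 * ((n : ℝ) ^ 3 / 6) := by gcongr
  have h5 : (B.card : ℝ) * (s * (n : ℝ) ^ 2 / 2) ≤ (s * n) * (s * (n : ℝ) ^ 2 / 2) := by
    linarith
  exact le_of_mul_le_mul_right h5 (by positivity)

/-- If only few vertices lie outside `W` and all vertices of `W` have small missing degree, then a
maximum matching inside `W` leaves at most two vertices of `W` uncovered. -/
lemma exists_matching_of_small_missingDegree (hH : H ⊆ completeEdges n 3) (hn : 1000 < n)
    {W : Finset (Fin n)} (hW : 997 / 1000 * (n : ℝ) ≤ W.card)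
    (hmiss : ∀ v ∈ W, (missingDegree H v : ℝ) ≤ (n : ℝ) ^ 2 / 2000) :
    ∃ M ⊆ H.filter (· ⊆ W), IsMatchingFam M ∧ (W \ M.biUnion id).card ≤ 2 := by
  classical
  obtain ⟨M, hM', hmax'⟩ := exists_max_image
    ((H.filter (· ⊆ W)).powerset.filter IsMatchingFam) card
    ⟨∅, by simp [IsMatchingFam]⟩
  obtain ⟨hMH, hM⟩ := mem_filter.1 hM'
  rw [mem_powerset] at hMH
  have hmax : ∀ N ⊆ H.filter (· ⊆ W), IsMatchingFam N → N.card ≤ M.card := fun N hN hN' =>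
    hmax' N (mem_filter.2 ⟨mem_powerset.2 hN, hN'⟩)
  refine ⟨M, hMH, hM, ?_⟩
  by_contra hcon
  push Not at hcon
  set R := W \ M.biUnion id with hR
  obtain ⟨a, ha, b, hb, c, hc, hab, hac, hbc⟩ := two_lt_card.1 hcon
  have hpairs := choose_two_card_le_missingDegree hH hMH hM hmax hab hac hbc ha hb hc
  have hindep : ∀ e ∈ H, ¬ e ⊆ R := by
    intro e he heR
    have hd : ∀ g ∈ M, Disjoint e g := fun g hg =>
      disjoint_of_subset_left heR (disjoint_of_subset_right (subset_biUnion_of_mem id hg)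
        sdiff_disjoint)
    have heM : e ∉ M := fun h => by
      have h0 := disjoint_self_iff_empty e |>.1 (hd e h)
      have := mem_completeEdges_three.1 (hH he)
      simp [h0] at this
    have := hmax ({e} ∪ M)
      (union_subset (by simpa using ⟨he, heR.trans sdiff_subset⟩) hMH)
      ((isMatchingFam_singleton e).union hM fun g hg f hf => by
        rw [mem_singleton.1 hg]; exact hd f hf)
    rw [← insert_eq, card_insert_of_notMem heM] at this
    omega
  have hind := choose_two_le_missingDegree_of_independent hindep ha
  have hRc : R.card + 3 * M.card = W.card := by
    rw [← hM.card_biUnion fun e he => mem_completeEdges_three.1 (hH (mem_filter.1 (hMH he)).1)]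
    exact card_sdiff_add_card_eq_card
      (biUnion_subset.2 fun e he => (mem_filter.1 (hMH he)).2)
  have hma := hmiss a (mem_sdiff.1 ha).1
  have hmb := hmiss b (mem_sdiff.1 hb).1
  have hmc := hmiss c (mem_sdiff.1 hc).1
  have hindR : ((R.card - 1).choose 2 : ℝ) ≤ missingDegree H a := by exact_mod_cast hind
  have hpairsR : (M.card.choose 2 : ℝ) ≤
      missingDegree H a + missingDegree H b + missingDegree H c := by exact_mod_cast hpairs
  rw [Nat.cast_choose_two] at hindR hpairsR
  rw [Nat.cast_sub (by omega)] at hindR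
  have hRcR : (R.card : ℝ) + 3 * M.card = W.card := by exact_mod_cast hRc
  have hnR : (1000 : ℝ) < n := by exact_mod_cast hn
  have hr : (R.card : ℝ) ≤ n / 20 := by
    by_contra! h
    push_cast at hindR
    nlinarith
  have hm : 3 / 10 * (n : ℝ) ≤ M.card := by linarith
  nlinarith

end Counting

/-- A dense 3-graph with large minimum degree has a matching covering all but at most two
vertices. -/
theorem near_perfect_matching_dense_min_degree (ε β : ℝ)
    (hε0 : 0 < ε) (hε1 : ε < 1 / 1000000)
    (hβ0 : 3 * Real.sqrt ε < β) (hβ1 : β < 1) :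
    ∃ n0 : ℕ, 0 < n0 ∧ ∀ n : ℕ, n0 < n →
      ∀ H ⊆ completeEdges n 3,
        (1 - ε) * (n.choose 3 : ℝ) < (H.card : ℝ) →
        (∀ v : Fin n, β * (n : ℝ) ^ 2 < ((H.filter (fun e => v ∈ e)).card : ℝ)) →
        ∃ M ⊆ H, IsMatchingFam M ∧ (Finset.univ \ M.biUnion id).card ≤ 2 := by
  have hs0 : 0 < Real.sqrt ε := Real.sqrt_pos.2 hε0
  have hs2 : Real.sqrt ε ^ 2 = ε := Real.sq_sqrt hε0.le
  have hs1 : Real.sqrt ε ≤ 1 / 1000 := Real.sqrt_le_iff.2 ⟨by norm_num, by linarith⟩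
  refine ⟨1000, by norm_num, fun n hn H hH hcard hdeg => ?_⟩
  have hnR : (1000 : ℝ) < n := by exact_mod_cast hn
  set s := Real.sqrt ε with hs
  rw [← hs2] at hcard
  have hB := card_large_missingDegree_le hH hs0 (by omega) hcard
  set B := univ.filter (fun v => s * (n : ℝ) ^ 2 / 2 < missingDegree H v) with hBdef
  obtain ⟨M₀, hM₀H, hM₀, hM₀c, hBM₀⟩ := exists_matching_covering hH B fun v _ => by
    have h1 : 3 * (B.card : ℝ) * n ≤ 3 * (s * n) * n := by gcongr
    have h2 : 3 * s * (n : ℝ) ^ 2 ≤ β * (n : ℝ) ^ 2 := by gcongr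
    have h3 : 3 * (B.card : ℝ) * n < ((H.filter (fun e => v ∈ e)).card : ℝ) := by
      linarith [hdeg v]
    exact_mod_cast h3
  have hU : ((M₀.biUnion id).card : ℝ) ≤ 3 / 1000 * n := by
    rw [hM₀.card_biUnion fun e he => mem_completeEdges_three.1 (hH (hM₀H he))]
    have h1 : (M₀.card : ℝ) ≤ B.card := by exact_mod_cast hM₀c
    have h2 : s * n ≤ 1 / 1000 * n := by gcongr
    push_cast
    linarith
  obtain ⟨M, hMH, hM, hMc⟩ := exists_matching_of_small_missingDegree hH hn
    (W := univ \ M₀.biUnion id)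
    (by
      rw [cast_card_sdiff (subset_univ _), card_univ, Fintype.card_fin]
      linarith)
    (fun v hv => by
      have hvB : v ∉ B := fun h => (mem_sdiff.1 hv).2 (hBM₀ h)
      have h1 : (missingDegree H v : ℝ) ≤ s * (n : ℝ) ^ 2 / 2 := by simpa [hBdef] using hvB
      have h2 : s * (n : ℝ) ^ 2 ≤ 1 / 1000 * (n : ℝ) ^ 2 := by gcongr
      linarith)
  refine ⟨M₀ ∪ M, union_subset hM₀H (hMH.trans (filter_subset _ _)), hM₀.union hM ?_, ?_⟩
  · intro e he f hf
    exact disjoint_of_subset_left (subset_biUnion_of_mem id he)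
      (disjoint_of_subset_right (mem_filter.1 (hMH hf)).2 disjoint_sdiff)
  · rwa [union_biUnion, ← sup_eq_union, ← sdiff_sdiff_left]
end

section
/- For every integer k ≥ 3, every real α ∈ (0,1) satisfying 1 − (1−α)^k = k^k·α^k also satisfies 1/k − 1/(2k^2) < α < 1/k − 2/(5k^2). -/
/-- `a ↦ (1 - a)^k + (k a)^k - 1` is convex and vanishes at `0`, so scaling the argument by
`t ∈ [0, 1]` scales the value by at most `t`. -/
lemma one_sub_pow_add_mul_pow_scale_le (k : ℕ) (hk : k ≠ 0) {t a : ℝ} (ht0 : 0 ≤ t) (ht1 : t ≤ 1)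
    (ha0 : 0 ≤ a) (ha1 : a ≤ 1) :
    (1 - t * a) ^ k + (k * (t * a)) ^ k - 1 ≤ t * ((1 - a) ^ k + (k * a) ^ k - 1) := by
  have h := (convexOn_pow (𝕜 := ℝ) k).2 (x := 1 - a) (y := 1) (by simpa using ha1) (by simp)
    ht0 (sub_nonneg.2 ht1) (by ring)
  simp only [smul_eq_mul, one_pow, mul_one] at h
  rw [show t * (1 - a) + (1 - t) = 1 - t * a by ring] at h
  have h2 : (k * (t * a)) ^ k ≤ t * ((k : ℝ) * a) ^ k := by
    rw [show (k : ℝ) * (t * a) = t * (k * a) by ring, mul_pow]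
    exact mul_le_mul_of_nonneg_right (pow_le_of_le_one ht0 ht1 hk) (by positivity)
  linarith

lemma exp_mul_inv_pow (c : ℝ) {k : ℕ} (hk : k ≠ 0) : Real.exp (c * (k : ℝ)⁻¹) ^ k = Real.exp c := by
  rw [← Real.exp_nat_mul]
  congr 1
  field_simp

lemma one_sub_pow_add_mul_pow_lt_one (k : ℕ) (hk : 3 ≤ k) :
    (1 - (1 / (k : ℝ) - 1 / (2 * (k : ℝ) ^ 2))) ^ k
      + (k * (1 / (k : ℝ) - 1 / (2 * (k : ℝ) ^ 2))) ^ k < 1 := by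
  rcases lt_or_ge k 16 with h | h
  · interval_cases k <;> norm_num
  have hk0 : k ≠ 0 := by omega
  have hkr : (16 : ℝ) ≤ k := by exact_mod_cast h
  set u : ℝ := (k : ℝ)⁻¹ with hu
  have hu0 : 0 < u := by positivity
  have hu1 : u ≤ 1 / 16 := by rw [hu, inv_le_comm₀] <;> linarith
  have e1 : 1 - (1 / (k : ℝ) - 1 / (2 * (k : ℝ) ^ 2)) = 1 - u + u ^ 2 / 2 := by
    rw [hu]; field_simp; ring
  have e2 : k * (1 / (k : ℝ) - 1 / (2 * (k : ℝ) ^ 2)) = 1 - u / 2 := by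
    rw [hu]; field_simp
  rw [e1, e2]
  have b1 : (1 - u + u ^ 2 / 2) ^ k ≤ Real.exp (-(23 / 24)) := by
    rw [← exp_mul_inv_pow _ hk0]
    refine pow_le_pow_left₀ (by nlinarith) ?_ k
    have := Real.add_one_le_exp (-(23 / 24) * u)
    nlinarith
  have b2 : (1 - u / 2) ^ k ≤ Real.exp (-(1 / 2)) := by
    rw [← exp_mul_inv_pow _ hk0]
    refine pow_le_pow_left₀ (by linarith) ?_ k
    have := Real.add_one_le_exp (-(1 / 2) * u)
    linarith
  have c1 : Real.exp (-(23 / 24)) < 0.39 := by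
    have := Real.sum_le_exp_of_nonneg (x := 23 / 24) (by norm_num) 6
    norm_num [Finset.sum_range_succ, Nat.factorial] at this
    rw [Real.exp_neg]
    exact inv_lt_of_inv_lt₀ (by norm_num) (by norm_num; linarith)
  have c2 : Real.exp (-(1 / 2)) < 0.608 := by
    have := Real.sum_le_exp_of_nonneg (x := 1 / 2) (by norm_num) 5
    norm_num [Finset.sum_range_succ, Nat.factorial] at this
    rw [Real.exp_neg]
    exact inv_lt_of_inv_lt₀ (by norm_num) (by norm_num; linarith)
  linarith

lemma exp_neg_le_of_one_le_mul {x y : ℝ} (hx : 0 ≤ x) (h : 1 ≤ y * (1 + x)) : Real.exp (-x) ≤ y := by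
  rw [Real.exp_neg]
  calc (Real.exp x)⁻¹ ≤ (1 + x)⁻¹ :=
        inv_anti₀ (by linarith) (by linarith [Real.add_one_le_exp x])
    _ ≤ y := (inv_le_iff_one_le_mul₀ (by linarith)).2 h

lemma one_lt_one_sub_pow_add_mul_pow (k : ℕ) (hk : 3 ≤ k) :
    1 < (1 - (1 / (k : ℝ) - 2 / (5 * (k : ℝ) ^ 2))) ^ k
      + (k * (1 / (k : ℝ) - 2 / (5 * (k : ℝ) ^ 2))) ^ k := by
  rcases lt_or_ge k 16 with h | h
  · interval_cases k <;> norm_num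
  have hk0 : k ≠ 0 := by omega
  have hkr : (16 : ℝ) ≤ k := by exact_mod_cast h
  set u : ℝ := (k : ℝ)⁻¹ with hu
  have hu0 : 0 < u := by positivity
  have hu1 : u ≤ 1 / 16 := by rw [hu, inv_le_comm₀] <;> linarith
  have e1 : 1 - (1 / (k : ℝ) - 2 / (5 * (k : ℝ) ^ 2)) = 1 - u + 2 / 5 * u ^ 2 := by
    rw [hu]; field_simp; ring
  have e2 : k * (1 / (k : ℝ) - 2 / (5 * (k : ℝ) ^ 2)) = 1 - 2 / 5 * u := by
    rw [hu]; field_simp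
  rw [e1, e2]
  have b1 : Real.exp (-1.04) ≤ (1 - u + 2 / 5 * u ^ 2) ^ k := by
    rw [← exp_mul_inv_pow _ hk0, neg_mul]
    refine pow_le_pow_left₀ (Real.exp_nonneg _) (exp_neg_le_of_one_le_mul (by positivity) ?_) k
    have : 0 ≤ u * (0.04 - 0.64 * u + 0.416 * u ^ 2) := mul_nonneg hu0.le (by nlinarith)
    linarith
  have b2 : Real.exp (-0.42) ≤ (1 - 2 / 5 * u) ^ k := by
    rw [← exp_mul_inv_pow _ hk0, neg_mul]
    refine pow_le_pow_left₀ (Real.exp_nonneg _) (exp_neg_le_of_one_le_mul (by positivity) ?_) k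
    nlinarith
  have c1 : 0.353 < Real.exp (-1.04) := by
    rw [show (-1.04 : ℝ) = -1 + -0.04 by norm_num, Real.exp_add]
    have h1 := Real.exp_neg_one_gt_d9
    have h2 := Real.add_one_le_exp (-0.04)
    nlinarith
  have c2 : 0.65 < Real.exp (-0.42) := by
    rw [show (-0.42 : ℝ) = (14 : ℕ) * -0.03 by norm_num, Real.exp_nat_mul]
    calc (0.65 : ℝ) < 0.97 ^ 14 := by norm_num
      _ ≤ _ := pow_le_pow_left₀ (by norm_num) (by linarith [Real.add_one_le_exp (-0.03)]) _
  linarith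

/-- Any root `α ∈ (0,1)` of `1 - (1-α)^k = k^k·α^k` satisfies
`1/k - 1/(2k²) < α < 1/k - 2/(5k²)`. -/
theorem root_location (k : ℕ) (hk : 3 ≤ k) (α : ℝ) (h0 : 0 < α) (h1 : α < 1)
    (heq : 1 - (1 - α) ^ k = (k : ℝ) ^ k * α ^ k) :
    1 / (k : ℝ) - 1 / (2 * (k : ℝ) ^ 2) < α ∧ α < 1 / (k : ℝ) - 2 / (5 * (k : ℝ) ^ 2) := by
  have hk0 : k ≠ 0 := by omega
  have hkr : (3 : ℝ) ≤ k := by exact_mod_cast hk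
  rw [← mul_pow] at heq
  constructor <;> by_contra! h
  · have hlt := one_sub_pow_add_mul_pow_lt_one k hk
    set a := 1 / (k : ℝ) - 1 / (2 * (k : ℝ) ^ 2) with ha
    have ha0 : 0 < a := h0.trans_le h
    have ha1 : a ≤ 1 := by
      have : 1 / (k : ℝ) ≤ 1 := by rw [div_le_one] <;> linarith
      have : 0 < 1 / (2 * (k : ℝ) ^ 2) := by positivity
      linarith
    have ht : 0 < α / a := by positivity
    have := one_sub_pow_add_mul_pow_scale_le k hk0 ht.le ((div_le_one ha0).2 h) ha0.le ha1
    rw [div_mul_cancel₀ _ ha0.ne'] at this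
    nlinarith
  · have hlt := one_lt_one_sub_pow_add_mul_pow k hk
    set b := 1 / (k : ℝ) - 2 / (5 * (k : ℝ) ^ 2) with hb
    have hb0 : 0 ≤ b := by
      have : b = (5 * k - 2) / (5 * (k : ℝ) ^ 2) := by rw [hb]; field_simp
      rw [this]
      exact div_nonneg (by linarith) (by positivity)
    have := one_sub_pow_add_mul_pow_scale_le k hk0 (div_nonneg hb0 h0.le)
      ((div_le_one h0).2 h) h0.le h1.le
    rw [div_mul_cancel₀ _ h0.ne', show (1 - α) ^ k + (k * α) ^ k - 1 = 0 by linarith] at this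
    linarith
end
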